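/- arXiv:math/0104062 — 3 statements merged into one kernel-verified Lean document; each statement's English description precedes it below -/
import Mathlib

section
/- Let A be a noetherian commutative ring whose nilradical is a prime ideal (equivalently, Spec A is irreducible), and let B be a commutative A-algebra such that the structure map A → B is injective and B is a finite flat A-module. Suppose there exists a prime ideal P of A such that the induced map κ(P) → B ⊗_A κ(P) on the fibre over P is bijective, where κ(P) denotes the residue field of A at P. Then the structure map A → B is bijective, i.e. an isomorphism of rings. -/
/-- Let `A` be a noetherian commutative ring whose nilradical is
prime (i.e. `Spec A` is irreducible) and let `B` be a commutative `A`-algebra with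
injective structure map which is finite and flat as an `A`-module. If for some
prime ideal `P` of `A` the canonical map `κ(P) → B ⊗_A κ(P)` to the fibre over `P`
is bijective (the fibre is a single reduced point), then the structure map
`A → B` is bijective. -/
theorem stmt_1 {A B : Type*} [CommRing A] [IsNoetherianRing A]
    (hA : (nilradical A).IsPrime)
    [CommRing B] [Algebra A B]
    (hinj : Function.Injective (algebraMap A B))
    [Module.Finite A B] [Module.Flat A B]
    (P : Ideal A) [P.IsPrime]
    (hfib : Function.Bijective
      (algebraMap (IsLocalRing.ResidueField (Localization.AtPrime P))
        (TensorProduct A (IsLocalRing.ResidueField (Localization.AtPrime P)) B))) :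
    Function.Bijective (algebraMap A B) := by
  rw [← Module.algebraMap_bijective_iff_rankAtStalk]
  have hP : Module.rankAtStalk (R := A) B ⟨P, inferInstance⟩ = 1 := by
    rw [Module.rankAtStalk_eq]
    exact (LinearEquiv.ofBijective (Algebra.linearMap _ _) hfib).finrank_eq.symm.trans
      (Module.finrank_self _)
  have key (Q : PrimeSpectrum A) :
      Module.rankAtStalk (R := A) B ⟨nilradical A, hA⟩ = Module.rankAtStalk (R := A) B Q :=
    Module.rankAtStalk_eq_of_le_of_finite_of_flat B (nilradical_le_prime Q.asIdeal)
  funext Q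
  rw [Pi.one_apply, ← key Q, key ⟨P, inferInstance⟩, hP]
end

section
/- Let n ≥ 1 be a natural number, let F be a complex-valued function analytic on a neighborhood of the origin in ℂ² × ℂ, written F((x,y),t), and let a, b : ℂ → ℂ be functions analytic near 0 with a(0) = 0 and b(0) = 0. Suppose there is ε > 0 such that for every t ∈ ℂ with |t| < ε the function (x,y) ↦ F((x + a(t), y + b(t)), t) vanishes to order at least n at the origin, i.e. all its iterated (Fréchet) derivatives of order < n vanish at (0,0). Then the function (x,y) ↦ (∂F/∂t)((x,y),0) (the first derivative of F in the t-variable, evaluated at t = 0) vanishes to order at least n−1 at the origin, i.e. all its iterated (Fréchet) derivatives of order < n−1 vanish at (0,0). -/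
open Filter Topology

section PartialDerivatives

universe u

variable {𝕜 : Type*} [NontriviallyNormedField 𝕜]

theorem DifferentiableAt.fderiv_prodMk_left {E G : Type*}
    [NormedAddCommGroup E] [NormedSpace 𝕜 E] [NormedAddCommGroup G] [NormedSpace 𝕜 G]
    {f : E × 𝕜 → G} {x : E} {t : 𝕜} (hf : DifferentiableAt 𝕜 f (x, t)) :
    fderiv 𝕜 (fun y => f (y, t)) x = (fderiv 𝕜 f (x, t)).comp (.inl 𝕜 E 𝕜) :=
  (hf.hasFDerivAt.comp x (hasFDerivAt_prodMk_left x t)).fderiv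

theorem DifferentiableAt.deriv_prodMk_right {E G : Type*}
    [NormedAddCommGroup E] [NormedSpace 𝕜 E] [NormedAddCommGroup G] [NormedSpace 𝕜 G]
    {f : E × 𝕜 → G} {x : E} {t : 𝕜} (hf : DifferentiableAt 𝕜 f (x, t)) :
    deriv (fun u => f (x, u)) t = fderiv 𝕜 f (x, t) (0, 1) :=
  (hf.hasFDerivAt.comp_hasDerivAt t ((hasDerivAt_const t x).prodMk (hasDerivAt_id t))).deriv

/-- The partial derivatives in the vector variable and in the scalar variable commute. -/
theorem AnalyticAt.fderiv_deriv_prodMk {E G : Type*}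
    [NormedAddCommGroup E] [NormedSpace 𝕜 E]
    [NormedAddCommGroup G] [NormedSpace 𝕜 G] [CompleteSpace G]
    {f : E × 𝕜 → G} {x : E} {t : 𝕜} (hf : AnalyticAt 𝕜 f (x, t)) :
    fderiv 𝕜 (fun y => deriv (fun u => f (y, u)) t) x =
      deriv (fun u => (fderiv 𝕜 f (x, u)).comp (.inl 𝕜 E 𝕜)) t := by
  have hd : DifferentiableAt 𝕜 (fderiv 𝕜 f) (x, t) := hf.fderiv.differentiableAt
  have hx : (fun y => deriv (fun u => f (y, u)) t) =ᶠ[𝓝 x]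
      fun y => fderiv 𝕜 f (y, t) (0, 1) := by
    have hc : Tendsto (fun y : E => (y, t)) (𝓝 x) (𝓝 (x, t)) :=
      (Continuous.prodMk_left t).tendsto x
    filter_upwards [hc.eventually hf.eventually_analyticAt] with y hy
    exact hy.differentiableAt.deriv_prodMk_right
  have hline : HasFDerivAt (fun y => fderiv 𝕜 f (y, t))
      ((fderiv 𝕜 (fderiv 𝕜 f) (x, t)).comp (.inl 𝕜 E 𝕜)) x :=
    hd.hasFDerivAt.comp x (hasFDerivAt_prodMk_left x t)
  have hdx := hline.clm_apply (hasFDerivAt_const ((0, 1) : E × 𝕜) x)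
  have hdt := (hd.hasFDerivAt.comp_hasDerivAt t
    ((hasDerivAt_const t x).prodMk (hasDerivAt_id t))).clm_comp
      (hasDerivAt_const t (ContinuousLinearMap.inl 𝕜 E 𝕜))
  have hsymm : IsSymmSndFDerivAt 𝕜 f (x, t) :=
    hf.contDiffAt.isSymmSndFDerivAt (n := ⊤) le_top
  rw [hx.fderiv_eq]
  refine hdx.fderiv.trans (Eq.trans ?_ hdt.deriv.symm)
  ext v
  simpa using hsymm (v, 0) (0, 1)

theorem iteratedFDeriv_succ_eq_zero_iff {E G : Type*}
    [NormedAddCommGroup E] [NormedSpace 𝕜 E] [NormedAddCommGroup G] [NormedSpace 𝕜 G]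
    {f : E → G} {x : E} {k : ℕ} :
    iteratedFDeriv 𝕜 (k + 1) f x = 0 ↔ iteratedFDeriv 𝕜 k (fderiv 𝕜 f) x = 0 := by
  rw [← norm_eq_zero, ← norm_iteratedFDeriv_fderiv, norm_eq_zero]

/-- If the `k`-th derivative of `f (·, t)` vanishes along a differentiable curve `z t` and
the next derivative vanishes at its starting point, then the `k`-th derivative of
`∂f/∂t` vanishes there. -/
theorem iteratedFDeriv_deriv_eq_zero_of_eventually {E : Type u} {G : Type u}
    [NormedAddCommGroup E] [NormedSpace 𝕜 E]
    [NormedAddCommGroup G] [NormedSpace 𝕜 G] [CompleteSpace G]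
    {f : E × 𝕜 → G} {z : 𝕜 → E} {t₀ : 𝕜} (hz : DifferentiableAt 𝕜 z t₀)
    (hf : AnalyticAt 𝕜 f (z t₀, t₀)) (k : ℕ)
    (hk : ∀ᶠ t in 𝓝 t₀, iteratedFDeriv 𝕜 k (fun x => f (x, t)) (z t) = 0)
    (hk' : iteratedFDeriv 𝕜 (k + 1) (fun x => f (x, t₀)) (z t₀) = 0) :
    iteratedFDeriv 𝕜 k (fun x => deriv (fun t => f (x, t)) t₀) (z t₀) = 0 := by
  induction k generalizing G with
  | zero =>
    have hzero : ∀ {g : E → G} {x : E}, iteratedFDeriv 𝕜 0 g x = 0 ↔ g x = 0 := by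
      intro g x
      rw [← norm_eq_zero, norm_iteratedFDeriv_zero, norm_eq_zero]
    have hd := hf.differentiableAt
    rw [iteratedFDeriv_succ_eq_zero_iff, ← norm_eq_zero, norm_iteratedFDeriv_zero, norm_eq_zero,
      hd.fderiv_prodMk_left] at hk'
    rw [hzero, hd.deriv_prodMk_right]
    have hcurve : HasDerivAt (fun t => f (z t, t)) (fderiv 𝕜 f (z t₀, t₀) (deriv z t₀, 1)) t₀ :=
      hd.hasFDerivAt.comp_hasDerivAt_of_eq t₀ (hz.hasDerivAt.prodMk (hasDerivAt_id t₀)) rfl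
    have hconst : (fun t => f (z t, t)) =ᶠ[𝓝 t₀] fun _ => 0 := by
      filter_upwards [hk] with t ht using hzero.1 ht
    have hsum := hcurve.deriv.symm.trans (hconst.deriv_eq.trans (deriv_const t₀ (0 : G)))
    have hleft : fderiv 𝕜 f (z t₀, t₀) (deriv z t₀, 0) = 0 := by
      simpa using congrArg (fun L => L (deriv z t₀)) hk'
    have hsplit : ((deriv z t₀, 1) : E × 𝕜) = (deriv z t₀, 0) + (0, 1) := by simp
    rwa [hsplit, map_add, hleft, zero_add] at hsum
  | succ k ih =>
    have hc : Tendsto (fun t => (z t, t)) (𝓝 t₀) (𝓝 (z t₀, t₀)) :=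
      hz.continuousAt.prodMk continuousAt_id
    have hslice : ∀ᶠ t in 𝓝 t₀, fderiv 𝕜 (fun x => f (x, t)) =ᶠ[𝓝 (z t)]
        fun x => (fderiv 𝕜 f (x, t)).comp (.inl 𝕜 E 𝕜) := by
      filter_upwards [hc.eventually hf.eventually_analyticAt] with t ht
      have hct : Tendsto (fun y : E => (y, t)) (𝓝 (z t)) (𝓝 (z t, t)) :=
        (Continuous.prodMk_left t).tendsto _
      filter_upwards [hct.eventually ht.eventually_analyticAt] with x hx
      exact hx.differentiableAt.fderiv_prodMk_left
    have hmixed : fderiv 𝕜 (fun x => deriv (fun t => f (x, t)) t₀) =ᶠ[𝓝 (z t₀)]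
        fun x => deriv (fun t => (fderiv 𝕜 f (x, t)).comp (.inl 𝕜 E 𝕜)) t₀ := by
      have hct : Tendsto (fun y : E => (y, t₀)) (𝓝 (z t₀)) (𝓝 (z t₀, t₀)) :=
        (Continuous.prodMk_left t₀).tendsto _
      filter_upwards [hct.eventually hf.eventually_analyticAt] with x hx
      exact hx.fderiv_deriv_prodMk
    rw [iteratedFDeriv_succ_eq_zero_iff, (hmixed.iteratedFDeriv 𝕜 k).eq_of_nhds]
    refine ih (f := fun p => (fderiv 𝕜 f p).comp (.inl 𝕜 E 𝕜)) ?_ ?_ ?_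
    · exact (((ContinuousLinearMap.compL 𝕜 E (E × 𝕜) G).flip
        (.inl 𝕜 E 𝕜)).analyticAt _).comp hf.fderiv
    · filter_upwards [hk, hslice] with t ht hst
      rw [← (hst.iteratedFDeriv 𝕜 k).eq_of_nhds]
      exact iteratedFDeriv_succ_eq_zero_iff.1 ht
    · rw [← (hslice.self_of_nhds.iteratedFDeriv 𝕜 (k + 1)).eq_of_nhds]
      exact iteratedFDeriv_succ_eq_zero_iff.1 hk'

end PartialDerivatives

/-- Let `n ≥ 1`, let `F((x,y),t)` be a complex-valued function
analytic on a neighborhood of the origin of `ℂ² × ℂ`, and let `a, b : ℂ → ℂ` be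
analytic near `0` with `a 0 = 0` and `b 0 = 0`. If there is `ε > 0` such that for
every `t` with `|t| < ε` the function `(x,y) ↦ F((x + a t, y + b t), t)` vanishes
to order at least `n` at the origin (all iterated Fréchet derivatives of order
`< n` vanish at `(0,0)`), then `(x,y) ↦ (∂F/∂t)((x,y),0)` vanishes to order at
least `n - 1` at the origin. -/
theorem stmt_5 (n : ℕ) (hn : 1 ≤ n) (F : (ℂ × ℂ) × ℂ → ℂ)
    (s : Set ((ℂ × ℂ) × ℂ)) (hs : s ∈ 𝓝 (0 : (ℂ × ℂ) × ℂ))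
    (hF : AnalyticOnNhd ℂ F s)
    (a b : ℂ → ℂ) (ha : AnalyticAt ℂ a 0) (hb : AnalyticAt ℂ b 0)
    (ha0 : a 0 = 0) (hb0 : b 0 = 0)
    (ε : ℝ) (hε : 0 < ε)
    (hvan : ∀ t : ℂ, ‖t‖ < ε → ∀ k < n,
      iteratedFDeriv ℂ k
        (fun xy : ℂ × ℂ => F ((xy.1 + a t, xy.2 + b t), t)) 0 = 0) :
    ∀ k < n - 1,
      iteratedFDeriv ℂ k
        (fun xy : ℂ × ℂ => deriv (fun t : ℂ => F (xy, t)) 0) 0 = 0 := by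
  intro k hk
  have hz : AnalyticAt ℂ (fun t => (a t, b t)) 0 := ha.prod hb
  have hz0 : (a 0, b 0) = (0 : ℂ × ℂ) := by rw [ha0, hb0]; rfl
  have htrans : ∀ t : ℂ, ‖t‖ < ε → ∀ j < n,
      iteratedFDeriv ℂ j (fun xy : ℂ × ℂ => F (xy, t)) (a t, b t) = 0 := by
    intro t ht j hj
    have h := iteratedFDeriv_comp_add_right (𝕜 := ℂ) (f := fun xy : ℂ × ℂ => F (xy, t)) j
      (a t, b t) 0
    rw [zero_add] at h
    rw [← h]
    exact hvan t ht j hj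
  have hF0 : AnalyticAt ℂ F ((a 0, b 0), 0) := by
    rw [hz0]
    exact hF 0 (mem_of_mem_nhds hs)
  have hev : ∀ᶠ t in 𝓝 (0 : ℂ),
      iteratedFDeriv ℂ k (fun xy : ℂ × ℂ => F (xy, t)) (a t, b t) = 0 := by
    filter_upwards [Metric.ball_mem_nhds (0 : ℂ) hε] with t ht
    exact htrans t (mem_ball_zero_iff.1 ht) k (by omega)
  have h := iteratedFDeriv_deriv_eq_zero_of_eventually hz.differentiableAt hF0 k hev
    (htrans 0 (by simpa using hε) (k + 1) (by omega))
  simpa only [hz0] using h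
end

section
/- Let r ≥ 1 and let Q be a symmetric r×r real matrix such that Q_{ij} ≥ 0 for all i ≠ j. Suppose there exists a vector n ∈ ℝ^r with n_i > 0 for every i and Q·n = 0, and suppose Q is connected in the sense that there is no partition of the index set {1,…,r} into two nonempty subsets I and J with Q_{ij} = 0 for all i ∈ I and j ∈ J. Then Q is negative semidefinite (i.e. xᵀQx ≤ 0 for all x ∈ ℝ^r), and the kernel {x ∈ ℝ^r : Q·x = 0} is exactly the line ℝ·n spanned by n. -/
open Matrix

namespace Matrix

variable {ι : Type*} {Q : Matrix ι ι ℝ} {n : ι → ℝ}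

theorem mul_sq_sub_nonneg (hoff : ∀ i j, i ≠ j → 0 ≤ Q i j) (hn : ∀ i, 0 < n i)
    (x : ι → ℝ) (i j : ι) : 0 ≤ Q i j * (n i * n j) * (x i / n i - x j / n j) ^ 2 := by
  rcases eq_or_ne i j with rfl | hij
  · simp
  · exact mul_nonneg (mul_nonneg (hoff i j hij) (mul_pos (hn i) (hn j)).le) (sq_nonneg _)

variable [Fintype ι]

/-- A symmetric matrix killing a nowhere vanishing vector `n` has a quadratic form which is a
combination of the squares of the differences `x i / n i - x j / n j`. -/
theorem IsSymm.sum_mul_sq_sub_eq (hsymm : Q.IsSymm) (hn : ∀ i, n i ≠ 0) (hQn : Q *ᵥ n = 0)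
    (x : ι → ℝ) :
    ∑ i, ∑ j, Q i j * (n i * n j) * (x i / n i - x j / n j) ^ 2 = -2 * (x ⬝ᵥ Q *ᵥ x) := by
  have hrow (i : ι) : ∑ j, Q i j * n j = 0 := congrFun hQn i
  have hterm (i j : ι) : Q i j * (n i * n j) * (x i / n i - x j / n j) ^ 2 =
      x i ^ 2 / n i * (Q i j * n j) + x j ^ 2 / n j * (Q j i * n i)
        - 2 * (x i * (Q i j * x j)) := by
    have hi := hn i
    have hj := hn j
    rw [hsymm.apply i j]
    field_simp
    ring
  have hleft : ∑ i, ∑ j, x i ^ 2 / n i * (Q i j * n j) = 0 := by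
    simp only [← Finset.mul_sum, hrow, mul_zero, Finset.sum_const_zero]
  have hright : ∑ i, ∑ j, x j ^ 2 / n j * (Q j i * n i) = 0 := by
    rw [Finset.sum_comm, hleft]
  simp only [hterm, Finset.sum_sub_distrib, Finset.sum_add_distrib, hleft, hright]
  simp only [← Finset.mul_sum, dotProduct, mulVec]
  ring

/-- On an isotropic vector `x`, the ratios `x i / n i` agree at adjacent indices. -/
theorem IsSymm.div_eq_div_of_dotProduct_mulVec_eq_zero (hsymm : Q.IsSymm)
    (hoff : ∀ i j, i ≠ j → 0 ≤ Q i j) (hn : ∀ i, 0 < n i) (hQn : Q *ᵥ n = 0) {x : ι → ℝ}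
    (hx : x ⬝ᵥ Q *ᵥ x = 0) {i j : ι} (hij : Q i j ≠ 0) : x i / n i = x j / n j := by
  have hsum := hsymm.sum_mul_sq_sub_eq (fun i => (hn i).ne') hQn x
  have hnonneg := mul_sq_sub_nonneg hoff hn x
  rw [hx, mul_zero, Finset.sum_eq_zero_iff_of_nonneg
    fun i _ => Finset.sum_nonneg fun j _ => hnonneg i j] at hsum
  have hterm := (Finset.sum_eq_zero_iff_of_nonneg fun j _ => hnonneg i j).1
    (hsum i (Finset.mem_univ i)) j (Finset.mem_univ j)
  have hcoef : Q i j * (n i * n j) ≠ 0 := mul_ne_zero hij (mul_pos (hn i) (hn j)).ne'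
  exact sub_eq_zero.1 (pow_eq_zero_iff two_ne_zero |>.1 ((mul_eq_zero.1 hterm).resolve_left hcoef))

end Matrix

/-- **Zariski's Lemma, linear-algebra form.** Let `Q` be a symmetric
`r×r` real matrix with non-negative off-diagonal entries, admitting a strictly
positive vector `n` in its kernel, and connected in the sense that no nontrivial
partition `I ⊔ Iᶜ` of the index set satisfies `Q i j = 0` for `i ∈ I`, `j ∈ Iᶜ`.
Then `Q` is negative semidefinite and its kernel is exactly the line `ℝ·n`. -/
theorem stmt_7 (r : ℕ) (hr : 1 ≤ r) (Q : Matrix (Fin r) (Fin r) ℝ)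
    (hsymm : Q.IsSymm)
    (hoff : ∀ i j : Fin r, i ≠ j → 0 ≤ Q i j)
    (n : Fin r → ℝ) (hn : ∀ i, 0 < n i) (hQn : Q.mulVec n = 0)
    (hconn : ¬ ∃ I : Set (Fin r), I.Nonempty ∧ Iᶜ.Nonempty ∧
      ∀ i ∈ I, ∀ j ∈ Iᶜ, Q i j = 0) :
    (∀ x : Fin r → ℝ, x ⬝ᵥ Q.mulVec x ≤ 0) ∧
    (∀ x : Fin r → ℝ, Q.mulVec x = 0 ↔ ∃ c : ℝ, x = c • n) := by
  refine ⟨fun x => ?_, fun x => ⟨fun hx => ?_, ?_⟩⟩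
  · have hsum := hsymm.sum_mul_sq_sub_eq (fun i => (hn i).ne') hQn x
    have hnonneg := Finset.sum_nonneg fun i (_ : i ∈ Finset.univ) =>
      Finset.sum_nonneg fun j (_ : j ∈ Finset.univ) => mul_sq_sub_nonneg hoff hn x i j
    linarith
  · have hform : x ⬝ᵥ Q *ᵥ x = 0 := by rw [hx, dotProduct_zero]
    let k : Fin r := ⟨0, hr⟩
    have hconst (i : Fin r) : x i / n i = x k / n k := by
      by_contra hi
      refine hconn ⟨{i | x i / n i = x k / n k}, ⟨k, rfl⟩, ⟨i, hi⟩, fun a ha b hb => ?_⟩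
      by_contra hab
      exact hb ((hsymm.div_eq_div_of_dotProduct_mulVec_eq_zero hoff hn hQn hform hab).symm.trans ha)
    exact ⟨x k / n k, funext fun i => (div_eq_iff (hn i).ne').1 (hconst i)⟩
  · rintro ⟨c, rfl⟩
    rw [mulVec_smul, hQn, smul_zero]
end
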